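/- arXiv:1508.00063 — 6 statements merged into one kernel-verified Lean document; each statement's English description precedes it below -/
import Mathlib

section
/- Let a > 1, A > 0, B > 0 be real numbers and let y : (0,∞) → ℝ be a nonnegative C¹ function satisfying y'(t) ≤ A − B·y(t)^a for all t > 0. Then for every t > 0, y(t) ≤ (A/B)^(1/a) + (1/(B·(a−1)·t))^(1/(a−1)). -/
open Set Real

/-- **ODE hyper-contractivity lemma.**  If `y` is a nonnegative `C¹` function on `(0,∞)`
satisfying `y' ≤ A - B·y^a` with `a > 1`, `A, B > 0`, then
`y(t) ≤ (A/B)^(1/a) + (1/(B(a-1)t))^(1/(a-1))` for every `t > 0`. -/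
theorem ode_hypercontractive (a A B : ℝ) (ha : 1 < a) (hA : 0 < A) (hB : 0 < B)
    (y y' : ℝ → ℝ)
    (hy_nonneg : ∀ t ∈ Ioi (0:ℝ), 0 ≤ y t)
    (hy_deriv : ∀ t ∈ Ioi (0:ℝ), HasDerivAt y (y' t) t)
    (hy'_cont : ContinuousOn y' (Ioi 0))
    (hineq : ∀ t ∈ Ioi (0:ℝ), y' t ≤ A - B * y t ^ a) :
    ∀ t ∈ Ioi (0:ℝ),
      y t ≤ (A / B) ^ (1 / a) + (1 / (B * (a - 1) * t)) ^ (1 / (a - 1)) := by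
  intro t ht
  have ht0 : 0 < t := ht
  set M := (A / B) ^ (1 / a) with hM
  have hM0 : 0 < M := by positivity
  have hMa : B * M ^ a = A := by
    rw [hM, ← Real.rpow_mul (by positivity), one_div, inv_mul_cancel₀ (by linarith), Real.rpow_one]
    field_simp
  have ha1 : 0 < a - 1 := by linarith
  have hK : 0 < B * (a - 1) := by positivity
  rcases le_or_gt (y t) M with h | hyt
  · have : 0 ≤ (1 / (B * (a - 1) * t)) ^ (1 / (a - 1)) := by positivity
    linarith
  have hgt : ∀ s ∈ Ioc 0 t, M < y s := by
    intro s hs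
    by_contra! hle
    have hsub : ∀ x ∈ Icc s t, x ∈ Ioi (0:ℝ) := fun x hx => lt_of_lt_of_le hs.1 hx.1
    have := image_le_of_deriv_right_lt_deriv_boundary (f := y) (f' := y') (a := s) (b := t)
      (B := fun _ => (M + y t) / 2) (B' := fun _ => 0)
      (fun x hx => (hy_deriv x (hsub x hx)).continuousAt.continuousWithinAt)
      (fun x hx => (hy_deriv x (hsub x (Ico_subset_Icc_self hx))).hasDerivWithinAt)
      (by linarith) (fun x => hasDerivAt_const x _)
      (fun x hx he => by
        have h1 := hineq x (hsub x (Ico_subset_Icc_self hx))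
        have h2 : M ^ a < y x ^ a := Real.rpow_lt_rpow hM0.le (by linarith) (by linarith)
        nlinarith) (right_mem_Icc.2 hs.2)
    linarith
  have hder : ∀ x ∈ Ioc 0 t, HasDerivAt (fun s => (y s - M) ^ (1 - a) - B * (a - 1) * s)
      (y' x * (1 - a) * (y x - M) ^ (1 - a - 1) - B * (a - 1) * 1) x := by
    intro x hx
    exact (((hy_deriv x hx.1).sub_const M).rpow_const
      (Or.inl (by have := hgt x hx; linarith))).sub ((hasDerivAt_id x).const_mul _)
  have hnn : ∀ x ∈ Ioc 0 t, 0 ≤ y' x * (1 - a) * (y x - M) ^ (1 - a - 1) - B * (a - 1) * 1 := by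
    intro x hx
    have hz : 0 < y x - M := by have := hgt x hx; linarith
    have h1 := hineq x hx.1
    have h2 := Real.add_rpow_le_rpow_add hM0.le hz.le ha.le
    rw [add_sub_cancel] at h2
    have h3 : y' x ≤ - (B * (y x - M) ^ a) := by nlinarith
    have h4 : (1 - a - 1) = -a := by ring
    rw [h4, Real.rpow_neg hz.le]
    have hp : 0 < (y x - M) ^ a := by positivity
    have h5 : y' x * ((y x - M) ^ a)⁻¹ ≤ -B := by
      rw [← div_eq_mul_inv, div_le_iff₀ hp]; linarith
    nlinarith
  have hmono : MonotoneOn (fun s => (y s - M) ^ (1 - a) - B * (a - 1) * s) (Ioc 0 t) := by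
    apply monotoneOn_of_deriv_nonneg (convex_Ioc 0 t)
    · exact fun x hx => (hder x hx).continuousAt.continuousWithinAt
    · exact fun x hx => (hder x (interior_subset hx)).differentiableAt.differentiableWithinAt
    · intro x hx
      rw [(hder x (interior_subset hx)).deriv]
      exact hnn x (interior_subset hx)
  have hzt : 0 < y t - M := by linarith
  have key : B * (a - 1) * t ≤ (y t - M) ^ (1 - a) := by
    by_contra! hlt
    set d := B * (a - 1) * t - (y t - M) ^ (1 - a) with hd
    have hd0 : 0 < d := by linarith
    have hs : min t (d / (B * (a - 1))) ∈ Ioc 0 t := ⟨lt_min ht0 (by positivity), min_le_left _ _⟩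
    have h1 := hmono hs ⟨ht0, le_rfl⟩ hs.2
    have h2 := min_le_right t (d / (B * (a - 1)))
    rw [le_div_iff₀ hK] at h2
    have hz : 0 < y (min t (d / (B * (a - 1)))) - M := by have := hgt _ hs; linarith
    have h3 := Real.rpow_pos_of_pos hz (1 - a)
    simp only at h1
    linarith
  have hfin : y t - M ≤ (1 / (B * (a - 1) * t)) ^ (1 / (a - 1)) := by
    rw [one_div (a - 1), Real.le_rpow_inv_iff_of_pos hzt.le (by positivity) ha1,
      le_div_iff₀ (by positivity)]
    have h4 : (1 - a) = -(a - 1) := by ring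
    rw [h4, Real.rpow_neg hzt.le] at key
    have hp : 0 < (y t - M) ^ (a - 1) := by positivity
    calc _ ≤ (y t - M) ^ (a - 1) * ((y t - M) ^ (a - 1))⁻¹ := by gcongr
      _ = 1 := mul_inv_cancel₀ hp.ne'
  linarith
end

section
/- Let α ≥ 1 be real, let m : [0,∞) → ℝ be a nonnegative C¹ function with m(0) = m₀ > 0, and let g : [0,∞) → ℝ satisfy m'(t) = (1 − m(t))·g(t) and g(t) ≥ m(t)^α for all t ≥ 0. Then for every t ≥ 0, |1 − m(t)| ≤ |1 − m₀|·exp(−min{1, m₀^α}·t). -/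
open Set Real

/-- **Exponential convergence of the mass to 1.**  If `m` is a nonnegative `C¹` function
on `[0,∞)` with `m(0) = m₀ > 0` satisfying `m' = (1 - m)·g` with `g ≥ m^α`, `α ≥ 1`, then
`|1 - m(t)| ≤ |1 - m₀|·exp(-min{1, m₀^α}·t)` for all `t ≥ 0`. -/
theorem mass_exp_decay (α m₀ : ℝ) (hα : 1 ≤ α) (hm₀ : 0 < m₀)
    (m m' g : ℝ → ℝ)
    (hm_nonneg : ∀ t ∈ Ici (0:ℝ), 0 ≤ m t)
    (hm_deriv : ∀ t ∈ Ici (0:ℝ), HasDerivWithinAt m (m' t) (Ici 0) t)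
    (hm'_cont : ContinuousOn m' (Ici 0))
    (hm0 : m 0 = m₀)
    (heq : ∀ t ∈ Ici (0:ℝ), m' t = (1 - m t) * g t)
    (hg : ∀ t ∈ Ici (0:ℝ), m t ^ α ≤ g t) :
    ∀ t ∈ Ici (0:ℝ), |1 - m t| ≤ |1 - m₀| * Real.exp (-(min 1 (m₀ ^ α)) * t) := by
  have key : ∀ c : ℝ, (∀ t ∈ Ici (0:ℝ), (1 - m t) ^ 2 * (c - g t) ≤ 0) →
      AntitoneOn (fun t => (1 - m t) ^ 2 * Real.exp (2 * c * t)) (Ici 0) := by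
    intro c hc
    have hd : ∀ t ∈ Ici (0:ℝ), HasDerivWithinAt
        (fun t => (1 - m t) ^ 2 * Real.exp (2 * c * t))
        (2 * ((1 - m t) ^ 2 * (c - g t)) * Real.exp (2 * c * t)) (Ici 0) t := by
      intro t ht
      have h1 := ((hm_deriv t ht).const_sub 1).pow 2
      have h2 : HasDerivWithinAt (fun t : ℝ => Real.exp (2 * c * t))
          (Real.exp (2 * c * t) * (2 * c * 1)) (Ici 0) t :=
        (((hasDerivAt_id t).const_mul (2 * c)).exp).hasDerivWithinAt
      refine (h1.mul h2).congr_deriv ?_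
      rw [heq t ht]
      simp
      ring
    refine antitoneOn_of_hasDerivWithinAt_nonpos (convex_Ici 0)
      (fun t ht => (hd t ht).continuousWithinAt)
      (fun t ht => (hd t (interior_subset ht)).mono interior_subset) ?_
    intro t ht
    have := hc t (interior_subset ht)
    exact mul_nonpos_of_nonpos_of_nonneg (by linarith) (Real.exp_pos _).le
  have hgn : ∀ t ∈ Ici (0:ℝ), 0 ≤ g t := fun t ht =>
    (Real.rpow_nonneg (hm_nonneg t ht) α).trans (hg t ht)
  have hw : AntitoneOn (fun t => (1 - m t) ^ 2) (Ici 0) := by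
    have := key 0 (fun t ht => mul_nonpos_of_nonneg_of_nonpos (sq_nonneg _)
      (by linarith [hgn t ht]))
    simpa using this
  have hcont : ContinuousOn m (Ici 0) := fun t ht => (hm_deriv t ht).continuousWithinAt
  have hα0 : 0 ≤ α := by linarith
  have hgc : ∀ t ∈ Ici (0:ℝ), min 1 (m₀ ^ α) ≤ g t := by
    intro t ht
    refine le_trans ?_ (hg t ht)
    rcases le_or_gt m₀ 1 with h | h
    · have h1 : (1 - m t) ^ 2 ≤ (1 - m 0) ^ 2 := hw self_mem_Ici ht ht
      rw [hm0] at h1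
      have h2 := abs_le_of_sq_le_sq h1 (by linarith)
      exact (min_le_right _ _).trans
        (Real.rpow_le_rpow hm₀.le (by linarith [(abs_le.mp h2).2]) hα0)
    · have h1 : 1 ≤ m t := by
        by_contra hlt
        push Not at hlt
        obtain ⟨s, hs, hs1⟩ := intermediate_value_Icc' (show (0:ℝ) ≤ t from ht)
          (hcont.mono Icc_subset_Ici_self) (show (1:ℝ) ∈ Icc (m t) (m 0) from
            ⟨hlt.le, by rw [hm0]; exact h.le⟩)
        have h3 : (1 - m t) ^ 2 ≤ (1 - m s) ^ 2 := hw hs.1 ht hs.2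
        rw [hs1] at h3
        nlinarith
      exact (min_le_left _ _).trans (Real.one_le_rpow h1 hα0)
  intro t ht
  have h := key (min 1 (m₀ ^ α)) (fun t ht => mul_nonpos_of_nonneg_of_nonpos (sq_nonneg _)
      (by linarith [hgc t ht])) self_mem_Ici ht ht
  set c := min 1 (m₀ ^ α)
  simp only [hm0, mul_zero, Real.exp_zero, mul_one] at h
  have e1 : Real.exp (2 * c * t) = Real.exp (c * t) ^ 2 := by
    rw [← Real.exp_nat_mul]; congr 1; push_cast; ring
  rw [e1, ← mul_pow] at h
  have h5 := sq_le_sq.mp h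
  rw [abs_mul, abs_of_pos (Real.exp_pos _)] at h5
  rw [neg_mul, Real.exp_neg, ← div_eq_mul_inv, le_div_iff₀ (Real.exp_pos _)]
  exact h5
end

section
/- Let α ≥ 1 be real, let m : [0,∞) → ℝ be a nonnegative C¹ function with m(0) = m₀ and 0 < m₀ < 1, and let g : [0,∞) → ℝ satisfy m'(t) = (1 − m(t))·g(t) and g(t) ≥ m(t)^α for all t ≥ 0. Then m is nondecreasing, m(t) ≤ 1 for all t ≥ 0, and m(t) ≥ 1 − (1 − m₀)·exp(−m₀^α·t) for every t ≥ 0. -/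
open Set Real

/-- **Mass dynamics in the subcritical case `m₀ < 1`.**  If `m` is a nonnegative `C¹`
function on `[0,∞)` with `m(0) = m₀`, `0 < m₀ < 1`, satisfying `m' = (1 - m)·g` with
`g ≥ m^α`, `α ≥ 1`, then `m` is nondecreasing, bounded above by `1`, and
`m(t) ≥ 1 - (1 - m₀)·exp(-m₀^α·t)` for all `t ≥ 0`. -/
theorem mass_increasing (α m₀ : ℝ) (hα : 1 ≤ α) (hm₀ : 0 < m₀) (hm₀1 : m₀ < 1)
    (m m' g : ℝ → ℝ)
    (hm_nonneg : ∀ t ∈ Ici (0:ℝ), 0 ≤ m t)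
    (hm_deriv : ∀ t ∈ Ici (0:ℝ), HasDerivWithinAt m (m' t) (Ici 0) t)
    (hm'_cont : ContinuousOn m' (Ici 0))
    (hm0 : m 0 = m₀)
    (heq : ∀ t ∈ Ici (0:ℝ), m' t = (1 - m t) * g t)
    (hg : ∀ t ∈ Ici (0:ℝ), m t ^ α ≤ g t) :
    MonotoneOn m (Ici 0) ∧ (∀ t ∈ Ici (0:ℝ), m t ≤ 1) ∧
      ∀ t ∈ Ici (0:ℝ), 1 - (1 - m₀) * Real.exp (-(m₀ ^ α) * t) ≤ m t := by
  have hcont : ContinuousOn m (Ici 0) := fun t ht => (hm_deriv t ht).continuousWithinAt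
  have hg0 : ∀ t ∈ Ici (0:ℝ), 0 ≤ g t := fun t ht =>
    (Real.rpow_nonneg (hm_nonneg t ht) α).trans (hg t ht)
  have hle : ∀ t ∈ Ici (0:ℝ), m t ≤ 1 := by
    intro t ht
    have ht0 : (0:ℝ) ≤ t := ht
    have key : ∀ ε : ℝ, 0 < ε → m t ≤ 1 + ε * (1 + t) := by
      intro ε hε
      have hB : ∀ x : ℝ, HasDerivAt (fun x : ℝ => 1 + ε * (1 + x)) ε x := by
        intro x
        simpa using (((hasDerivAt_id x).const_add 1).const_mul ε).const_add 1
      refine image_le_of_deriv_right_lt_deriv_boundary (f := m) (f' := m') (a := 0) (b := t)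
        (B := fun x : ℝ => 1 + ε * (1 + x)) (B' := fun _ => ε)
        (hcont.mono Icc_subset_Ici_self) ?_ ?_ hB ?_ (right_mem_Icc.2 ht0)
      · intro x hx
        exact (hm_deriv x hx.1).mono (Ici_subset_Ici.2 hx.1)
      · simp only [hm0]; linarith
      · intro x hx hxe
        have hx0 : (0:ℝ) ≤ x := hx.1
        have h1 : 0 ≤ ε * (1 + x) := by positivity
        have h2 := hg0 x hx0
        have h3 : (1 - m x) * g x ≤ 0 :=
          mul_nonpos_of_nonpos_of_nonneg (by linarith) h2
        rw [heq x hx0]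
        linarith
    refine le_of_forall_pos_le_add fun δ hδ => ?_
    have h := key (δ / (1 + t)) (by positivity)
    rwa [div_mul_cancel₀ _ (by positivity)] at h
  have hmono : MonotoneOn m (Ici 0) := by
    refine monotoneOn_of_hasDerivWithinAt_nonneg (f' := m') (convex_Ici 0) hcont ?_ ?_
    · intro x hx
      exact (hm_deriv x (interior_subset hx)).mono interior_subset
    · intro x hx
      have hx := interior_subset hx
      rw [heq x hx]
      exact mul_nonneg (sub_nonneg.2 (hle x hx)) (hg0 x hx)
  refine ⟨hmono, hle, ?_⟩
  intro t ht
  have hd : ∀ x ∈ Ici (0:ℝ), HasDerivWithinAt (fun x => (1 - m x) * Real.exp (m₀ ^ α * x))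
      (-(m' x) * Real.exp (m₀ ^ α * x) + (1 - m x) * (Real.exp (m₀ ^ α * x) * (m₀ ^ α)))
      (Ici 0) x := by
    intro x hx
    have he : HasDerivAt (fun x : ℝ => Real.exp (m₀ ^ α * x))
        (Real.exp (m₀ ^ α * x) * (m₀ ^ α)) x := by
      simpa using ((hasDerivAt_id x).const_mul (m₀ ^ α)).exp
    exact ((hm_deriv x hx).const_sub 1).mul he.hasDerivWithinAt
  have hanti : AntitoneOn (fun x => (1 - m x) * Real.exp (m₀ ^ α * x)) (Ici 0) := by
    refine antitoneOn_of_hasDerivWithinAt_nonpos (convex_Ici 0)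
      (fun x hx => (hd x hx).continuousWithinAt)
      (fun x hx => (hd x (interior_subset hx)).mono interior_subset) ?_
    intro x hx
    have hx : x ∈ Ici (0:ℝ) := interior_subset hx
    have h1 : m₀ ≤ m x := hm0 ▸ hmono self_mem_Ici hx hx
    have h2 : m₀ ^ α ≤ g x :=
      (Real.rpow_le_rpow hm₀.le h1 (by linarith)).trans (hg x hx)
    have h3 := mul_nonneg (mul_nonneg (sub_nonneg.2 (hle x hx)) (sub_nonneg.2 h2))
      (Real.exp_pos (m₀ ^ α * x)).le
    rw [heq x hx]
    linarith
  have h := hanti self_mem_Ici ht ht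
  simp only [hm0, mul_zero, Real.exp_zero, mul_one] at h
  have h4 := mul_le_mul_of_nonneg_right h (Real.exp_pos (-(m₀ ^ α) * t)).le
  rw [mul_assoc, ← Real.exp_add] at h4
  have h5 : m₀ ^ α * t + -(m₀ ^ α) * t = 0 := by ring
  rw [h5, Real.exp_zero] at h4
  linarith
end

section
/- Let α ≥ 1 be real, let m : [0,∞) → ℝ be a nonnegative C¹ function with m(0) = m₀ > 1, and let g : [0,∞) → ℝ satisfy m'(t) = (1 − m(t))·g(t) and g(t) ≥ m(t)^α for all t ≥ 0. Then m is nonincreasing, m(t) ≥ 1 for all t ≥ 0, and m(t) ≤ 1 + (m₀ − 1)·exp(−t) for every t ≥ 0. -/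
open Set Real

/-- **Mass dynamics in the supercritical case `m₀ > 1`.**  If `m` is a nonnegative `C¹`
function on `[0,∞)` with `m(0) = m₀ > 1` satisfying `m' = (1 - m)·g` with `g ≥ m^α`,
`α ≥ 1`, then `m` is nonincreasing, bounded below by `1`, and
`m(t) ≤ 1 + (m₀ - 1)·exp(-t)` for all `t ≥ 0`. -/
theorem mass_decreasing (α m₀ : ℝ) (hα : 1 ≤ α) (hm₀ : 1 < m₀)
    (m m' g : ℝ → ℝ)
    (hm_nonneg : ∀ t ∈ Ici (0:ℝ), 0 ≤ m t)
    (hm_deriv : ∀ t ∈ Ici (0:ℝ), HasDerivWithinAt m (m' t) (Ici 0) t)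
    (hm'_cont : ContinuousOn m' (Ici 0))
    (hm0 : m 0 = m₀)
    (heq : ∀ t ∈ Ici (0:ℝ), m' t = (1 - m t) * g t)
    (hg : ∀ t ∈ Ici (0:ℝ), m t ^ α ≤ g t) :
    AntitoneOn m (Ici 0) ∧ (∀ t ∈ Ici (0:ℝ), 1 ≤ m t) ∧
      ∀ t ∈ Ici (0:ℝ), m t ≤ 1 + (m₀ - 1) * Real.exp (-t) := by
  have hcont : ContinuousOn m (Ici 0) := fun t ht => (hm_deriv t ht).continuousWithinAt
  have hg0 : ∀ t ∈ Ici (0:ℝ), 0 ≤ g t := fun t ht =>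
    (Real.rpow_nonneg (hm_nonneg t ht) α).trans (hg t ht)
  have hone : ∀ t ∈ Ici (0:ℝ), 1 ≤ m t := by
    intro t ht
    by_contra! hlt
    have hsub : Icc 0 t ⊆ Ici (0:ℝ) := fun x hx => hx.1
    have hclosed : IsClosed (Icc 0 t ∩ m ⁻¹' Ici 1) :=
      (hcont.mono hsub).preimage_isClosed_of_isClosed isClosed_Icc isClosed_Ici
    have hcomp : IsCompact (Icc 0 t ∩ m ⁻¹' Ici 1) :=
      isCompact_Icc.of_isClosed_subset hclosed inter_subset_left
    have hne : (Icc 0 t ∩ m ⁻¹' Ici 1).Nonempty :=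
      ⟨0, ⟨le_refl 0, ht⟩, by simp only [mem_preimage, mem_Ici, hm0]; exact hm₀.le⟩
    obtain ⟨s, ⟨hs, hms⟩, hmax⟩ := hcomp.exists_isGreatest hne
    have hsub2 : Icc s t ⊆ Ici (0:ℝ) := fun x hx => hs.1.trans hx.1
    have hmono : MonotoneOn m (Icc s t) := by
      refine monotoneOn_of_hasDerivWithinAt_nonneg (f' := m') (convex_Icc s t)
        (hcont.mono hsub2) ?_ ?_
      · intro x hx
        exact (hm_deriv x (hsub2 (interior_subset hx))).mono
          (interior_subset.trans hsub2)
      · intro x hx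
        have hx0 := hsub2 (interior_subset hx)
        rw [interior_Icc] at hx
        have : m x < 1 := by
          by_contra! h
          exact absurd (hmax ⟨⟨hx0, hx.2.le⟩, h⟩) (not_le.mpr hx.1)
        rw [heq x hx0]
        exact mul_nonneg (by linarith) (hg0 x hx0)
    have h1 := hmono (left_mem_Icc.mpr hs.2) (right_mem_Icc.mpr hs.2) hs.2
    have h2 : 1 ≤ m s := hms
    linarith
  refine ⟨?_, hone, ?_⟩
  · refine antitoneOn_of_hasDerivWithinAt_nonpos (f' := m') (convex_Ici 0) hcont ?_ ?_
    · intro x hx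
      exact (hm_deriv x (interior_subset hx)).mono interior_subset
    · intro x hx
      have hx0 := interior_subset hx
      rw [heq x hx0]
      exact mul_nonpos_of_nonpos_of_nonneg (by linarith [hone x hx0]) (hg0 x hx0)
  · have hanti : AntitoneOn (fun t => (m t - 1) * Real.exp t) (Ici 0) := by
      refine antitoneOn_of_hasDerivWithinAt_nonpos
        (f' := fun t => m' t * Real.exp t + (m t - 1) * Real.exp t) (convex_Ici 0)
        ((hcont.sub continuousOn_const).mul Real.continuous_exp.continuousOn) ?_ ?_
      · intro x hx
        exact (((hm_deriv x (interior_subset hx)).mono interior_subset).sub_const 1).mul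
          (Real.hasDerivAt_exp x).hasDerivWithinAt
      · intro x hx
        have hx0 := interior_subset hx
        have h1 := hone x hx0
        have h2 : 1 ≤ g x := (Real.one_le_rpow h1 (by linarith)).trans (hg x hx0)
        have h3 : 0 ≤ (m x - 1) * (g x - 1) * Real.exp x :=
          mul_nonneg (mul_nonneg (by linarith) (by linarith)) (Real.exp_pos x).le
        simp only [heq x hx0]
        nlinarith
    intro t ht
    have h := hanti (mem_Ici.mpr le_rfl) ht ht
    simp only [Real.exp_zero, mul_one, hm0] at h
    have h2 := mul_le_mul_of_nonneg_right h (Real.exp_pos (-t)).le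
    rw [mul_assoc, ← Real.exp_add, add_neg_cancel, Real.exp_zero, mul_one] at h2
    linarith
end

section
/- Let 1 < α < 2, 1 < k < ∞, and 0 < m₀ < 1. There exists a constant C > 0, depending only on m₀, k and α, such that every nonnegative classical solution u of the one-dimensional nonlocal Fisher–KPP problem with initial mass ∫₀¹ u(0,x) dx = m₀ satisfies, for every t > 0, ( ∫₀¹ u(t,x)^k dx )^{1/k} ≤ C + C · t^{−(k−1)/(α−1)}. -/
open Set Real MeasureTheory intervalIntegral

/-- A (global) classical solution of the one-dimensional nonlocal Fisher–KPP problem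
`∂ₜu = ∂ₓₓu + u^α (1 - ∫₀¹ u dy)` on `Ω = (0,1)`, with Neumann boundary conditions.
`ut`, `ux`, `uxx` are the time derivative and the first and second spatial derivatives
of `u`; they exist on `(0,∞) × [0,1]` and are jointly continuous there, while `u`
itself is continuous on `[0,∞) × [0,1]`. -/
def IsKPPSolution (α : ℝ) (u ut ux uxx : ℝ → ℝ → ℝ) : Prop :=
  ContinuousOn (fun p : ℝ × ℝ => u p.1 p.2) (Ici 0 ×ˢ Icc 0 1) ∧
  ContinuousOn (fun p : ℝ × ℝ => ut p.1 p.2) (Ioi 0 ×ˢ Icc 0 1) ∧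
  ContinuousOn (fun p : ℝ × ℝ => ux p.1 p.2) (Ioi 0 ×ˢ Icc 0 1) ∧
  ContinuousOn (fun p : ℝ × ℝ => uxx p.1 p.2) (Ioi 0 ×ˢ Icc 0 1) ∧
  (∀ t ∈ Ioi (0:ℝ), ∀ x ∈ Icc (0:ℝ) 1, HasDerivAt (fun s => u s x) (ut t x) t) ∧
  (∀ t ∈ Ioi (0:ℝ), ∀ x ∈ Icc (0:ℝ) 1,
    HasDerivWithinAt (fun y => u t y) (ux t x) (Icc 0 1) x) ∧
  (∀ t ∈ Ioi (0:ℝ), ∀ x ∈ Icc (0:ℝ) 1,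
    HasDerivWithinAt (fun y => ux t y) (uxx t x) (Icc 0 1) x) ∧
  (∀ t ∈ Ioi (0:ℝ), ∀ x ∈ Icc (0:ℝ) 1,
    ut t x = uxx t x + u t x ^ α * (1 - ∫ y in (0:ℝ)..1, u t y)) ∧
  (∀ t ∈ Ioi (0:ℝ), ux t 0 = 0 ∧ ux t 1 = 0)

/-- Nonnegativity of a solution on `[0,∞) × [0,1]`. -/
def KPPNonneg (u : ℝ → ℝ → ℝ) : Prop :=
  ∀ t ∈ Ici (0:ℝ), ∀ x ∈ Icc (0:ℝ) 1, 0 ≤ u t x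


lemma sup_bound (k : ℝ) (hk : 1 < k) (v vx : ℝ → ℝ)
    (hvx : ContinuousOn vx (Icc 0 1))
    (hd : ∀ x ∈ Icc (0:ℝ) 1, HasDerivWithinAt v (vx x) (Icc 0 1) x)
    (hv1 : ∀ x ∈ Icc (0:ℝ) 1, 1 ≤ v x)
    (hmass : ∫ x in (0:ℝ)..1, v x ≤ 2) :
    ∃ M : ℝ, 1 ≤ M ∧ (∀ x ∈ Icc (0:ℝ) 1, v x ≤ M) ∧
      M ^ k ≤ 2 ^ (k + 1) + k ^ 2 * ∫ x in (0:ℝ)..1, v x ^ (k - 2) * vx x ^ 2 := by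
  have hvc : ContinuousOn v (Icc 0 1) := fun x hx => (hd x hx).continuousWithinAt
  have hne : (Icc (0:ℝ) 1).Nonempty := ⟨0, by simp⟩
  obtain ⟨x0, hx0, hmax⟩ := isCompact_Icc.exists_isMaxOn hne hvc
  obtain ⟨x1, hx1, hmin⟩ := isCompact_Icc.exists_isMinOn hne hvc
  have hmax' : ∀ x ∈ Icc (0:ℝ) 1, v x ≤ v x0 := fun x hx => hmax hx
  have hmin' : ∀ x ∈ Icc (0:ℝ) 1, v x1 ≤ v x := fun x hx => hmin hx
  have hu : uIcc (0:ℝ) 1 = Icc 0 1 := uIcc_of_le zero_le_one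
  have hvi : IntervalIntegrable v volume 0 1 := by
    apply ContinuousOn.intervalIntegrable; rwa [hu]
  have hx12 : v x1 ≤ 2 := by
    have : ∫ x in (0:ℝ)..1, v x1 ≤ ∫ x in (0:ℝ)..1, v x :=
      intervalIntegral.integral_mono_on zero_le_one (by simp) hvi hmin'
    simp at this
    linarith
  have hvne : ∀ p : ℝ, ContinuousOn (fun x => v x ^ p) (Icc 0 1) := fun p =>
    hvc.rpow_const (fun x hx => Or.inl (by have := hv1 x hx; linarith))
  set D := ∫ x in (0:ℝ)..1, v x ^ (k - 2) * vx x ^ 2 with hD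
  have hDc : ContinuousOn (fun x => v x ^ (k - 2) * vx x ^ 2) (Icc 0 1) :=
    (hvne _).mul (hvx.pow 2)
  have hgc : ContinuousOn (fun x => vx x * k * v x ^ (k - 1)) (Icc 0 1) :=
    (hvx.mul continuousOn_const).mul (hvne _)
  have hftc : ∫ x in x1..x0, vx x * k * v x ^ (k - 1) = v x0 ^ k - v x1 ^ k := by
    have hsub : uIcc x1 x0 ⊆ Icc 0 1 := by
      intro x hx
      rw [mem_uIcc] at hx
      rcases hx with h | h <;> constructor <;> linarith [hx0.1, hx0.2, hx1.1, hx1.2]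
    refine intervalIntegral.integral_eq_sub_of_hasDeriv_right ((hvne k).mono hsub) ?_
      (hgc.mono hsub).intervalIntegrable
    intro x hx
    have hx' : x ∈ Ioo (0:ℝ) 1 :=
      ⟨lt_of_le_of_lt (le_min hx1.1 hx0.1) hx.1, lt_of_lt_of_le hx.2 (max_le hx1.2 hx0.2)⟩
    have hxI := Ioo_subset_Icc_self hx'
    have := (hd x hxI).hasDerivAt (Icc_mem_nhds hx'.1 hx'.2)
    exact (this.rpow_const (Or.inl (by have := hv1 x hxI; linarith))).hasDerivWithinAt
  have hle : v x0 ^ k - v x1 ^ k ≤ ∫ x in (0:ℝ)..1, |vx x * k * v x ^ (k - 1)| := by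
    rw [← hftc]
    refine (le_abs_self _).trans ?_
    refine (intervalIntegral.norm_integral_le_integral_norm_uIoc (μ := volume)
      (f := fun x => vx x * k * v x ^ (k - 1)) (a := x1) (b := x0)).trans ?_
    rw [intervalIntegral.integral_of_le zero_le_one]
    have hint : IntegrableOn (fun x => |vx x * k * v x ^ (k - 1)|) (Ioc 0 1) volume :=
      (hgc.abs.integrableOn_Icc).mono_set Ioc_subset_Icc_self
    refine setIntegral_mono_set hint ?_ ?_
    · exact Filter.Eventually.of_forall (fun x => abs_nonneg _)
    · apply Filter.Eventually.of_forall
      intro x hx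
      exact ⟨lt_of_le_of_lt (le_min hx1.1 hx0.1) hx.1, hx.2.trans (max_le hx1.2 hx0.2)⟩
  have hpt : ∀ x ∈ Icc (0:ℝ) 1, |vx x * k * v x ^ (k - 1)| ≤
      v x0 ^ k / 2 + k ^ 2 / 2 * (v x ^ (k - 2) * vx x ^ 2) := by
    intro x hx
    have h1 := hv1 x hx
    have hp : 0 < v x := by linarith
    have e1 : v x ^ (k - 1) = v x ^ (k - 2) * v x := by
      rw [← Real.rpow_add_one hp.ne']; congr 1; ring
    have e2 : v x ^ k = v x ^ (k - 2) * v x * v x := by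
      rw [← e1, ← Real.rpow_add_one hp.ne']; congr 1; ring
    have e3 : v x ^ k ≤ v x0 ^ k := Real.rpow_le_rpow hp.le (hmax' x hx) (by linarith)
    have hq : 0 < v x ^ (k - 2) := Real.rpow_pos_of_pos hp _
    rw [abs_mul, abs_mul, e1, abs_of_pos (by linarith : 0 < k), abs_of_pos (by positivity : 0 < v x ^ (k-2) * v x)]
    have := mul_nonneg hq.le (sq_nonneg (v x - k * |vx x|))
    rw [← sq_abs (vx x)]
    nlinarith
  have hint : ∫ x in (0:ℝ)..1, |vx x * k * v x ^ (k - 1)| ≤ v x0 ^ k / 2 + k ^ 2 / 2 * D := by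
    have hi2 : IntervalIntegrable (fun x => k ^ 2 / 2 * (v x ^ (k - 2) * vx x ^ 2)) volume 0 1 := by
      apply ContinuousOn.intervalIntegrable; rw [hu]; exact continuousOn_const.mul hDc
    have := intervalIntegral.integral_mono_on (zero_le_one (α := ℝ))
      (f := fun x => |vx x * k * v x ^ (k - 1)|)
      (g := fun x => v x0 ^ k / 2 + k ^ 2 / 2 * (v x ^ (k - 2) * vx x ^ 2)) (μ := volume)
      (by apply ContinuousOn.intervalIntegrable; rw [hu]; exact hgc.abs)
      ((by simp : IntervalIntegrable (fun _ => v x0 ^ k / 2) volume 0 1).add hi2) hpt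
    rw [intervalIntegral.integral_add (by simp) hi2, intervalIntegral.integral_const_mul] at this
    simpa using this
  refine ⟨v x0, hv1 x0 hx0, hmax', ?_⟩
  have h2 : v x1 ^ k ≤ 2 ^ k := Real.rpow_le_rpow (by linarith [hv1 x1 hx1]) hx12 (by linarith)
  have h3 : (2:ℝ) ^ (k + 1) = 2 ^ k * 2 := Real.rpow_add_one (by norm_num) k
  rw [h3]
  linarith

lemma young (k α : ℝ) (hk : 1 < k) (hα1 : 1 < α) (hα2 : α < 2) :
    ∃ A : ℝ, 0 < A ∧ ∀ M : ℝ, 1 ≤ M →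
      2 * k * M ^ (k + α - 2) ≤ (k - 1) / (2 * k) * M ^ k + A := by
  set N : ℝ := 4 * k ^ 2 / (k - 1) with hN
  have hk1 : 0 < k - 1 := by linarith
  have hN0 : 0 < N := by positivity
  set Ms : ℝ := N ^ (1 / (2 - α)) with hMs
  have hMs0 : 0 < Ms := Real.rpow_pos_of_pos hN0 _
  refine ⟨2 * k * Ms ^ (k + α - 2), by positivity, fun M hM => ?_⟩
  have hM0 : 0 < M := by linarith
  rcases le_total M Ms with h | h
  · have h1 : M ^ (k + α - 2) ≤ Ms ^ (k + α - 2) := Real.rpow_le_rpow hM0.le h (by linarith)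
    have h2 : 0 < (k - 1) / (2 * k) * M ^ k := by positivity
    have : 2 * k * M ^ (k + α - 2) ≤ 2 * k * Ms ^ (k + α - 2) := by gcongr
    linarith
  · have h1 : N ≤ M ^ (2 - α) := by
      have := Real.rpow_le_rpow hMs0.le h (by linarith : 0 ≤ 2 - α)
      rwa [hMs, ← Real.rpow_mul hN0.le, one_div, inv_mul_cancel₀ (by linarith), Real.rpow_one] at this
    have h2 : M ^ k = M ^ (2 - α) * M ^ (k + α - 2) := by
      rw [← Real.rpow_add hM0]; congr 1; ring
    have h3 : 0 < M ^ (k + α - 2) := by positivity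
    have h4 : 2 * k * M ^ (k + α - 2) = (k - 1) / (2 * k) * (N * M ^ (k + α - 2)) := by
      rw [hN]; field_simp; ring
    have h5 : (k - 1) / (2 * k) * (N * M ^ (k + α - 2)) ≤ (k - 1) / (2 * k) * M ^ k := by
      rw [h2]; gcongr
    have : 0 < 2 * k * Ms ^ (k + α - 2) := by positivity
    linarith

lemma ode_bound (γ c A : ℝ) (hγ : 1 < γ) (hc : 0 < c) (hA : 0 < A) :
    ∃ C : ℝ, 0 < C ∧ ∀ y y' : ℝ → ℝ, (∀ t, 0 < t → HasDerivAt y (y' t) t) →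
      (∀ t, 0 < t → 1 ≤ y t) → (∀ t, 0 < t → y' t ≤ A - c * y t ^ γ) →
      ∀ t, 0 < t → y t ≤ C + C * t ^ (-(1 / (γ - 1))) := by
  set Y : ℝ := (2 * A / c) ^ (1 / γ) with hY
  have hY0 : 0 < Y := by positivity
  have hYγ : c * Y ^ γ = 2 * A := by
    rw [hY, ← Real.rpow_mul (by positivity), one_div, inv_mul_cancel₀ (by linarith), Real.rpow_one]
    field_simp
  have hg1 : 0 < γ - 1 := by linarith
  set K : ℝ := (γ - 1) * c / 4 with hK
  have hK0 : 0 < K := by positivity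
  refine ⟨max Y (K ^ (-(1 / (γ - 1)))), lt_max_of_lt_left hY0, ?_⟩
  intro y y' hd h1 hle t ht
  set C := max Y (K ^ (-(1 / (γ - 1)))) with hC
  have hC0 : 0 < C := lt_max_of_lt_left hY0
  have htp : 0 < t ^ (-(1 / (γ - 1))) := Real.rpow_pos_of_pos ht _
  by_cases hex : ∃ s ∈ Icc (t / 2) t, y s ≤ Y
  · obtain ⟨s, hs, hys⟩ := hex
    have hs0 : 0 < s := by linarith [hs.1]
    have : y t ≤ Y := by
      refine image_le_of_deriv_right_lt_deriv_boundary (f := y) (f' := y') (a := s) (b := t)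
        (B := fun _ => Y) (B' := fun _ => 0) ?_ ?_ hys (fun x => hasDerivAt_const x Y) ?_
        ⟨hs.2, le_rfl⟩
      · intro x hx
        exact (hd x (by linarith [hx.1])).continuousAt.continuousWithinAt
      · intro x hx
        exact (hd x (by linarith [hx.1])).hasDerivWithinAt
      · intro x hx hxy
        have := hle x (by linarith [hx.1])
        rw [hxy, hYγ] at this
        linarith
    have h2 : Y ≤ C := le_max_left _ _
    have : 0 < C * t ^ (-(1 / (γ - 1))) := by positivity
    linarith
  · push Not at hex
    have hz : ∀ s ∈ Icc (t / 2) t, HasDerivAt (fun s => y s ^ (1 - γ))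
        (y' s * (1 - γ) * y s ^ (1 - γ - 1)) s := by
      intro s hs
      have hs0 : 0 < s := by linarith [hs.1]
      exact (hd s hs0).rpow_const (Or.inl (by linarith [h1 s hs0]))
    have key := (convex_Icc (t / 2) t).mul_sub_le_image_sub_of_le_deriv
      (f := fun s => y s ^ (1 - γ)) (C := 2 * K)
      (fun s hs => (hz s hs).continuousAt.continuousWithinAt)
      (fun s hs => (hz s (interior_subset hs)).differentiableAt.differentiableWithinAt)
      (by
        intro s hs
        have hs := interior_subset hs
        have hs0 : 0 < s := by linarith [hs.1]
        rw [(hz s hs).deriv]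
        have hp : 0 < y s := by linarith [h1 s hs0]
        have e : 1 - γ - 1 = -γ := by ring
        rw [e, Real.rpow_neg hp.le]
        have hyg : 0 < y s ^ γ := Real.rpow_pos_of_pos hp _
        have h3 : Y ^ γ ≤ y s ^ γ := Real.rpow_le_rpow hY0.le (hex s hs).le (by linarith)
        have h4 : y' s ≤ - (c / 2) * y s ^ γ := by
          have := hle s hs0
          nlinarith
        rw [← div_eq_mul_inv, le_div_iff₀ hyg, hK]
        nlinarith)
      (t / 2) ⟨le_rfl, by linarith⟩ t ⟨by linarith, le_rfl⟩ (by linarith)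
    have hp : 0 < y t := by linarith [h1 t ht]
    have hz2 : 0 < y (t / 2) ^ (1 - γ) :=
      Real.rpow_pos_of_pos (by linarith [h1 (t / 2) (by linarith)]) _
    have hzt : K * t ≤ y t ^ (1 - γ) := by
      linarith
    have h5 : y t = (y t ^ (1 - γ)) ^ (-(1 / (γ - 1))) := by
      rw [← Real.rpow_mul hp.le]
      have : (1 - γ) * -(1 / (γ - 1)) = 1 := by field_simp; ring
      rw [this, Real.rpow_one]
    have h6 : y t ≤ (K * t) ^ (-(1 / (γ - 1))) := by
      rw [h5]
      exact Real.rpow_le_rpow_of_nonpos (by positivity) hzt (by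
        have : 0 < 1 / (γ - 1) := by positivity
        linarith)
    rw [Real.mul_rpow hK0.le ht.le] at h6
    have h7 : K ^ (-(1 / (γ - 1))) * t ^ (-(1 / (γ - 1))) ≤ C * t ^ (-(1 / (γ - 1))) := by
      gcongr
      exact le_max_right _ _
    linarith

lemma hasDerivAt_param (G Gt : ℝ → ℝ → ℝ)
    (hG : ContinuousOn (fun p : ℝ × ℝ => G p.1 p.2) (Ioi 0 ×ˢ Icc 0 1))
    (hGt : ContinuousOn (fun p : ℝ × ℝ => Gt p.1 p.2) (Ioi 0 ×ˢ Icc 0 1))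
    (hd : ∀ t ∈ Ioi (0:ℝ), ∀ x ∈ Icc (0:ℝ) 1, HasDerivAt (fun s => G s x) (Gt t x) t)
    (t : ℝ) (ht : 0 < t) :
    HasDerivAt (fun s => ∫ x in (0:ℝ)..1, G s x) (∫ x in (0:ℝ)..1, Gt t x) t := by
  have sl : ∀ H : ℝ → ℝ → ℝ, ContinuousOn (fun p : ℝ × ℝ => H p.1 p.2) (Ioi 0 ×ˢ Icc 0 1) →
      ∀ s, 0 < s → IntervalIntegrable (H s) volume 0 1 := by
    intro H hH s hs
    apply ContinuousOn.intervalIntegrable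
    rw [uIcc_of_le zero_le_one]
    exact hH.comp (f := fun x : ℝ => (s, x)) (by fun_prop) (fun x hx => ⟨hs, hx⟩)
  have hK : IsCompact (Icc (t / 2) (2 * t) ×ˢ Icc (0:ℝ) 1) := isCompact_Icc.prod isCompact_Icc
  obtain ⟨B, hB⟩ := hK.exists_bound_of_continuousOn (hGt.mono (fun p hp => 
    ⟨show 0 < p.1 by linarith [hp.1.1], hp.2⟩))
  have hui : uIoc (0:ℝ) 1 ⊆ Icc (0:ℝ) 1 := by
    rw [uIoc_of_le zero_le_one]; exact Ioc_subset_Icc_self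
  refine (intervalIntegral.hasDerivAt_integral_of_dominated_loc_of_deriv_le
    (F := G) (F' := Gt) (bound := fun _ => B) (s := Icc (t / 2) (2 * t))
    (Icc_mem_nhds (by linarith) (by linarith)) ?_ (sl G hG t ht) ?_ ?_ (by simp) ?_).2
  · filter_upwards [lt_mem_nhds ht] with s hs
    exact (sl G hG s hs).aestronglyMeasurable_restrict_uIoc
  · exact (sl Gt hGt t ht).aestronglyMeasurable_restrict_uIoc
  · exact Filter.Eventually.of_forall (fun x hx s hs => hB (s, x) ⟨hs, hui hx⟩)
  · exact Filter.Eventually.of_forall (fun x hx s hs =>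
      hd s (show 0 < s by linarith [hs.1]) x (hui hx))

lemma slice_cont (H : ℝ → ℝ → ℝ)
    (hH : ContinuousOn (fun p : ℝ × ℝ => H p.1 p.2) (Ioi 0 ×ˢ Icc 0 1)) (s : ℝ) (hs : 0 < s) :
    ContinuousOn (H s) (Icc 0 1) :=
  hH.comp (f := fun x : ℝ => (s, x)) (by fun_prop) (fun x hx => ⟨hs, hx⟩)

lemma ii_of_cont (f : ℝ → ℝ) (hf : ContinuousOn f (Icc 0 1)) :
    IntervalIntegrable f volume 0 1 := by
  apply ContinuousOn.intervalIntegrable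
  rwa [uIcc_of_le zero_le_one]

lemma mass_le_one (α : ℝ) (u ut ux uxx : ℝ → ℝ → ℝ)
    (h : IsKPPSolution α u ut ux uxx) (hn : KPPNonneg u)
    (h0 : (∫ x in (0:ℝ)..1, u 0 x) < 1) (t : ℝ) (ht : 0 < t) :
    (∫ x in (0:ℝ)..1, u t x) ≤ 1 := by
  obtain ⟨hu, hut, hux, huxx, hdt, hdx, hdxx, heq, hbc⟩ := h
  have hu' : ContinuousOn (fun p : ℝ × ℝ => u p.1 p.2) (Ioi 0 ×ˢ Icc 0 1) :=
    hu.mono (prod_mono Ioi_subset_Ici_self le_rfl)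
  have hd := hasDerivAt_param u ut hu' hut hdt
  set m : ℝ → ℝ := fun s => ∫ x in (0:ℝ)..1, u s x with hm
  -- continuity at zero
  obtain ⟨s, hs0, hst, hms⟩ : ∃ s, 0 < s ∧ s ≤ t ∧ m s ≤ 1 := by
    let U : ℝ → ℝ → ℝ := fun s x => u (max s 0) (max 0 (min 1 x))
    have hU : Continuous (Function.uncurry U) := by
      have : Continuous (fun p : ℝ × ℝ => (max p.1 0, max 0 (min 1 p.2))) := by fun_prop
      refine hu.comp_continuous this (fun p => ⟨mem_Ici.2 (le_max_right _ _), le_max_left _ _, ?_⟩)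
      exact max_le zero_le_one (min_le_left _ _)
    have hc := intervalIntegral.continuous_parametric_intervalIntegral_of_continuous'
      (μ := volume) hU 0 1
    have hUm : ∀ s, 0 ≤ s → ∫ x in (0:ℝ)..1, U s x = m s := by
      intro s hs
      apply intervalIntegral.integral_congr
      intro x hx
      rw [uIcc_of_le zero_le_one] at hx
      simp only [U]
      rw [max_eq_left hs, min_eq_right hx.2, max_eq_right hx.1]
    have hlt : ∫ x in (0:ℝ)..1, U 0 x < 1 := by rw [hUm 0 le_rfl]; exact h0
    have hev := (hc.tendsto 0).eventually (gt_mem_nhds hlt)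
    obtain ⟨ε, hε, hball⟩ := Metric.eventually_nhds_iff.1 hev
    refine ⟨min (ε / 2) t, by positivity, min_le_right _ _, ?_⟩
    have hp : 0 < min (ε / 2) t := by positivity
    rw [← hUm _ hp.le]
    refine (hball ?_).le
    rw [Real.dist_eq, sub_zero, abs_of_pos hp]
    have := min_le_left (ε / 2) t
    linarith
  have hder : ∀ x, 0 < x → 1 < m x → ∫ y in (0:ℝ)..1, ut x y ≤ 0 := by
    intro x hx hmx
    have hz : ∫ y in (0:ℝ)..1, uxx x y = 0 := by
      rw [intervalIntegral.integral_eq_sub_of_hasDerivAt_of_le zero_le_one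
        (slice_cont ux hux x hx) (fun y hy =>
          (hdxx x hx y (Ioo_subset_Icc_self hy)).hasDerivAt (Icc_mem_nhds hy.1 hy.2))
        (ii_of_cont _ (slice_cont uxx huxx x hx)), (hbc x hx).1, (hbc x hx).2, sub_zero]
    refine le_trans ?_ hz.le
    refine intervalIntegral.integral_mono_on zero_le_one
      (ii_of_cont _ (slice_cont ut hut x hx)) (ii_of_cont _ (slice_cont uxx huxx x hx)) ?_
    intro y hy
    rw [heq x hx y hy]
    have h1 : 0 ≤ u x y ^ α := Real.rpow_nonneg (hn x hx.le y hy) _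
    have h2 : 1 - (∫ y in (0:ℝ)..1, u x y) ≤ 0 := by
      change 1 - m x ≤ 0
      linarith
    nlinarith [mul_nonpos_of_nonneg_of_nonpos h1 h2]
  refine le_of_forall_pos_le_add ?_
  intro ε hε
  have hδ : 0 < ε / (1 + t) := by positivity
  set δ := ε / (1 + t) with hδd
  have key := image_le_of_deriv_right_lt_deriv_boundary (f := m)
    (f' := fun x => ∫ y in (0:ℝ)..1, ut x y) (a := s) (b := t)
    (B := fun x => 1 + δ * (1 + x)) (B' := fun _ => δ)
    (fun x hx => (hd x (by linarith [hx.1])).continuousAt.continuousWithinAt)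
    (fun x hx => (hd x (by linarith [hx.1])).hasDerivWithinAt)
    (by have : 0 < δ * (1 + s) := by positivity
        linarith)
    (fun x => by
      have := (((hasDerivAt_id x).const_add 1).const_mul δ).const_add 1
      simpa using this)
    (fun x hx hxe => by
      have hx0 : 0 < x := by linarith [hx.1]
      have : 0 < δ * (1 + x) := by positivity
      have := hder x hx0 (by rw [hxe]; linarith)
      exact lt_of_le_of_lt this hδ)
    (x := t) ⟨hst, le_rfl⟩
  have e : δ * (1 + t) = ε := by rw [hδd]; field_simp
  simp only [e] at key
  exact key

lemma energy (α k A : ℝ) (hα1 : 1 < α) (hk : 1 < k)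
    (hA : ∀ M : ℝ, 1 ≤ M → 2 * k * M ^ (k + α - 2) ≤ (k - 1) / (2 * k) * M ^ k + A)
    (u ut ux uxx : ℝ → ℝ → ℝ)
    (h : IsKPPSolution α u ut ux uxx) (hn : KPPNonneg u)
    (t : ℝ) (ht : 0 < t) (hm : (∫ x in (0:ℝ)..1, u t x) ≤ 1) :
    ∫ x in (0:ℝ)..1, ut t x * k * (u t x + 1) ^ (k - 1) ≤
      (A + (k - 1) / k * 2 ^ (k + 1)) - ((k - 1) / (2 * k) * (1 / 2) ^ (k / (k - 1))) *
        (∫ x in (0:ℝ)..1, (u t x + 1) ^ k) ^ (k / (k - 1)) := by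
  obtain ⟨hu, hut, hux, huxx, hdt, hdx, hdxx, heq, hbc⟩ := h
  have hu' : ContinuousOn (fun p : ℝ × ℝ => u p.1 p.2) (Ioi 0 ×ˢ Icc 0 1) :=
    hu.mono (prod_mono Ioi_subset_Ici_self le_rfl)
  have hk1 : 0 < k - 1 := by linarith
  set v : ℝ → ℝ := fun x => u t x + 1 with hv
  have huc := slice_cont u hu' t ht
  have hutc := slice_cont ut hut t ht
  have huxc := slice_cont ux hux t ht
  have huxxc := slice_cont uxx huxx t ht
  have hvc : ContinuousOn v (Icc 0 1) := huc.add continuousOn_const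
  have hv1 : ∀ x ∈ Icc (0:ℝ) 1, 1 ≤ v x := fun x hx => by
    have := hn t ht.le x hx
    simp only [hv]; linarith
  have hvp : ∀ x ∈ Icc (0:ℝ) 1, 0 < v x := fun x hx => by linarith [hv1 x hx]
  have hvd : ∀ x ∈ Icc (0:ℝ) 1, HasDerivWithinAt v (ux t x) (Icc 0 1) x := fun x hx =>
    (hdx t ht x hx).add_const 1
  have hvne : ∀ p : ℝ, ContinuousOn (fun x => v x ^ p) (Icc 0 1) := fun p =>
    hvc.rpow_const (fun x hx => Or.inl (hvp x hx).ne')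
  have hvmass : ∫ x in (0:ℝ)..1, v x ≤ 2 := by
    simp only [hv]
    rw [intervalIntegral.integral_add (ii_of_cont _ huc) (by simp)]
    simp
    linarith
  have hm0 : 0 ≤ ∫ x in (0:ℝ)..1, u t x :=
    intervalIntegral.integral_nonneg zero_le_one (fun x hx => hn t ht.le x hx)
  obtain ⟨M, hM1, hvM, hMD⟩ := sup_bound k hk v (ux t) huxc hvd hv1 hvmass
  have hM0 : 0 < M := by linarith
  set D := ∫ x in (0:ℝ)..1, v x ^ (k - 2) * ux t x ^ 2 with hD
  have hDc : ContinuousOn (fun x => v x ^ (k - 2) * ux t x ^ 2) (Icc 0 1) :=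
    (hvne _).mul (huxc.pow 2)
  have hEc : ContinuousOn (fun x => v x ^ (k - 1) * uxx t x) (Icc 0 1) := (hvne _).mul huxxc
  have hDi : ∀ a : ℝ, IntervalIntegrable (fun x => a * (v x ^ (k - 2) * ux t x ^ 2)) volume 0 1 :=
    fun a => ii_of_cont _ (continuousOn_const.mul hDc)
  have hEi : ∀ a : ℝ, IntervalIntegrable (fun x => a * (v x ^ (k - 1) * uxx t x)) volume 0 1 :=
    fun a => ii_of_cont _ (continuousOn_const.mul hEc)
  have hVi : ∀ a : ℝ, IntervalIntegrable (fun x => a * v x) volume 0 1 :=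
    fun a => ii_of_cont _ (continuousOn_const.mul hvc)
  have hibp : (k - 1) * D + ∫ x in (0:ℝ)..1, v x ^ (k - 1) * uxx t x = 0 := by
    have hF : ∀ x ∈ Ioo (0:ℝ) 1, HasDerivAt (fun x => v x ^ (k - 1) * ux t x)
        ((k - 1) * (v x ^ (k - 2) * ux t x ^ 2) + v x ^ (k - 1) * uxx t x) x := by
      intro x hx
      have hxI := Ioo_subset_Icc_self hx
      have h1 := ((hvd x hxI).hasDerivAt (Icc_mem_nhds hx.1 hx.2)).rpow_const (p := k - 1)
        (Or.inl (hvp x hxI).ne')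
      have h2 := (hdxx t ht x hxI).hasDerivAt (Icc_mem_nhds hx.1 hx.2)
      refine (h1.mul h2).congr_deriv ?_
      have : k - 1 - 1 = k - 2 := by ring
      rw [this]; ring
    have := intervalIntegral.integral_eq_sub_of_hasDerivAt_of_le zero_le_one
      ((hvne (k - 1)).mul huxc) hF ((hDi (k - 1)).add (ii_of_cont _ hEc))
    rw [intervalIntegral.integral_add (hDi _)
      (ii_of_cont _ hEc), intervalIntegral.integral_const_mul] at this
    rw [hD, this]
    simp [Pi.mul_apply, (hbc t ht).1, (hbc t ht).2]
  have hpt : ∀ x ∈ Icc (0:ℝ) 1, ut t x * k * v x ^ (k - 1) ≤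
      k * (v x ^ (k - 1) * uxx t x) + k * M ^ (k + α - 2) * v x := by
    intro x hx
    have hux0 := hn t ht.le x hx
    have hp := hvp x hx
    have hq : 0 < v x ^ (k - 1) := Real.rpow_pos_of_pos hp _
    have hle : u t x ^ α * (1 - ∫ y in (0:ℝ)..1, u t y) ≤ v x ^ α := by
      have h1 : u t x ^ α ≤ v x ^ α :=
        Real.rpow_le_rpow hux0 (by simp only [hv]; linarith) (by linarith)
      have h2 : 0 ≤ u t x ^ α := Real.rpow_nonneg hux0 _
      nlinarith
    have h3 : v x ^ (k - 1) * v x ^ α = v x ^ (k + α - 2) * v x := by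
      rw [← Real.rpow_add hp, ← Real.rpow_add_one hp.ne']; congr 1; ring
    have h4 : v x ^ (k + α - 2) ≤ M ^ (k + α - 2) :=
      Real.rpow_le_rpow hp.le (hvM x hx) (by linarith)
    have h5 : v x ^ (k - 1) * (u t x ^ α * (1 - ∫ y in (0:ℝ)..1, u t y)) ≤
        M ^ (k + α - 2) * v x := by
      calc _ ≤ v x ^ (k - 1) * v x ^ α := by gcongr
        _ = v x ^ (k + α - 2) * v x := h3
        _ ≤ _ := by gcongr
    have h6 := mul_le_mul_of_nonneg_left h5 (by linarith : 0 ≤ k)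
    rw [heq t ht x hx]
    nlinarith
  have hI : ∫ x in (0:ℝ)..1, ut t x * k * v x ^ (k - 1) ≤
      k * (∫ x in (0:ℝ)..1, v x ^ (k - 1) * uxx t x) +
        k * M ^ (k + α - 2) * ∫ x in (0:ℝ)..1, v x := by
    rw [← intervalIntegral.integral_const_mul, ← intervalIntegral.integral_const_mul,
      ← intervalIntegral.integral_add (hEi _) (hVi _)]
    exact intervalIntegral.integral_mono_on zero_le_one
      (ii_of_cont _ ((hutc.mul continuousOn_const).mul (hvne _)))
      ((hEi _).add (hVi _)) hpt
  have hy : ∫ x in (0:ℝ)..1, v x ^ k ≤ 2 * M ^ (k - 1) := by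
    have : ∫ x in (0:ℝ)..1, v x ^ k ≤ ∫ x in (0:ℝ)..1, M ^ (k - 1) * v x := by
      refine intervalIntegral.integral_mono_on zero_le_one (ii_of_cont _ (hvne k))
        (ii_of_cont _ (continuousOn_const.mul hvc)) ?_
      intro x hx
      have hp := hvp x hx
      have e : v x ^ k = v x ^ (k - 1) * v x := by
        rw [← Real.rpow_add_one hp.ne']; congr 1; ring
      rw [e]
      have := Real.rpow_le_rpow hp.le (hvM x hx) hk1.le
      gcongr
    rw [intervalIntegral.integral_const_mul] at this
    have hMk : 0 < M ^ (k - 1) := by positivity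
    nlinarith
  have hy0 : 0 ≤ ∫ x in (0:ℝ)..1, v x ^ k :=
    intervalIntegral.integral_nonneg zero_le_one
      (fun x hx => Real.rpow_nonneg (hvp x hx).le _)
  have hyg : (1 / 2) ^ (k / (k - 1)) * (∫ x in (0:ℝ)..1, v x ^ k) ^ (k / (k - 1)) ≤ M ^ k := by
    rw [← Real.mul_rpow (by norm_num) hy0]
    have e : M ^ k = (M ^ (k - 1)) ^ (k / (k - 1)) := by
      rw [← Real.rpow_mul hM0.le]; congr 1; field_simp
    rw [e]
    exact Real.rpow_le_rpow (by positivity) (by linarith) (by positivity)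
  have hMα : 0 < M ^ (k + α - 2) := by positivity
  have hAM := hA M hM1
  have s1 : k * M ^ (k + α - 2) * ∫ x in (0:ℝ)..1, v x ≤ 2 * k * M ^ (k + α - 2) := by
    have : 0 < k * M ^ (k + α - 2) := by positivity
    nlinarith
  have s2 : ∫ x in (0:ℝ)..1, v x ^ (k - 1) * uxx t x = -((k - 1) * D) := by linarith
  rw [s2] at hI
  have s3 : (k - 1) / k * M ^ k ≤ (k - 1) / k * 2 ^ (k + 1) + k * ((k - 1) * D) := by
    have : (k - 1) / k * M ^ k ≤ (k - 1) / k * (2 ^ (k + 1) + k ^ 2 * D) := by gcongr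
    have e : (k - 1) / k * (k ^ 2 * D) = k * ((k - 1) * D) := by field_simp
    linarith
  have s4 : (k - 1) / k = 2 * ((k - 1) / (2 * k)) := by field_simp
  have s5 := mul_le_mul_of_nonneg_left hyg (by positivity : 0 ≤ (k - 1) / (2 * k))
  have s6 : (k - 1) / k * M ^ k = 2 * ((k - 1) / (2 * k) * M ^ k) := by rw [s4]; ring
  linarith

/-- **Hyper-contractive `L^k` estimate, subcritical mass.**  For `1 < α < 2`, `k > 1` and
`0 < m₀ < 1` there is `C = C(m₀,k,α) > 0` such that every nonnegative classical solution
with initial mass `m₀` satisfies `‖u(t)‖_{L^k} ≤ C + C t^{-(k-1)/(α-1)}` for all `t > 0`. -/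
theorem Lk_hypercontractive_subcritical (α k m₀ : ℝ) (hα1 : 1 < α) (hα2 : α < 2)
    (hk : 1 < k) (hm₀ : 0 < m₀) (hm₀1 : m₀ < 1) :
    ∃ C > (0:ℝ), ∀ u ut ux uxx : ℝ → ℝ → ℝ,
      IsKPPSolution α u ut ux uxx → KPPNonneg u →
      (∫ x in (0:ℝ)..1, u 0 x) = m₀ →
      ∀ t ∈ Ioi (0:ℝ),
        (∫ x in (0:ℝ)..1, u t x ^ k) ^ (1 / k) ≤ C + C * t ^ (-(k - 1) / (α - 1)) := by
  have hk1 : 0 < k - 1 := by linarith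
  obtain ⟨A, hA0, hA⟩ := young k α hk hα1 hα2
  have hγ : 1 < k / (k - 1) := by rw [lt_div_iff₀ hk1]; linarith
  obtain ⟨C, hC0, hC⟩ := ode_bound (k / (k - 1))
    ((k - 1) / (2 * k) * (1 / 2) ^ (k / (k - 1))) (A + (k - 1) / k * 2 ^ (k + 1)) hγ
    (by positivity) (by positivity)
  refine ⟨(2 * C) ^ (1 / k), by positivity, ?_⟩
  intro u ut ux uxx h hn h0 t ht
  have ht0 : 0 < t := ht
  have h' := h
  obtain ⟨hu, hut, hux, huxx, hdt, hdx, hdxx, heq, hbc⟩ := h'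
  have hu' : ContinuousOn (fun p : ℝ × ℝ => u p.1 p.2) (Ioi 0 ×ˢ Icc 0 1) :=
    hu.mono (prod_mono Ioi_subset_Ici_self le_rfl)
  have hvne : ∀ p : ℝ, ContinuousOn (fun q : ℝ × ℝ => (u q.1 q.2 + 1) ^ p) (Ioi 0 ×ˢ Icc 0 1) :=
    fun p => (hu'.add continuousOn_const).rpow_const (fun q hq => Or.inl (by
      have := hn q.1 (mem_Ici.2 (le_of_lt (mem_Ioi.1 hq.1))) q.2 hq.2
      exact (by linarith : (0:ℝ) < u q.1 q.2 + 1).ne'))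
  have hder := hasDerivAt_param (fun s x => (u s x + 1) ^ k)
    (fun s x => ut s x * k * (u s x + 1) ^ (k - 1)) (hvne k)
    ((hut.mul continuousOn_const).mul (hvne (k - 1)))
    (fun s hs x hx => ((hdt s hs x hx).add_const 1).rpow_const (Or.inr hk.le))
  have hone : ∀ s, 0 < s → 1 ≤ ∫ x in (0:ℝ)..1, (u s x + 1) ^ k := by
    intro s hs
    have : ∫ x in (0:ℝ)..1, (1:ℝ) ≤ ∫ x in (0:ℝ)..1, (u s x + 1) ^ k := by
      refine intervalIntegral.integral_mono_on zero_le_one (by simp)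
        (ii_of_cont _ (slice_cont (fun s x => (u s x + 1) ^ k) (hvne k) s hs)) ?_
      intro x hx
      exact Real.one_le_rpow (by linarith [hn s hs.le x hx]) (by linarith)
    simpa using this
  have hb := hC (fun s => ∫ x in (0:ℝ)..1, (u s x + 1) ^ k) _ hder hone
    (fun s hs => energy α k A hα1 hk hA u ut ux uxx h hn s hs
      (mass_le_one α u ut ux uxx h hn (by linarith) s hs)) t ht
  have hexp : 1 / (k / (k - 1) - 1) = k - 1 := by
    have : k / (k - 1) - 1 = 1 / (k - 1) := by field_simp; ring
    rw [this, one_div_one_div]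
  rw [hexp] at hb
  have hle : ∫ x in (0:ℝ)..1, u t x ^ k ≤ ∫ x in (0:ℝ)..1, (u t x + 1) ^ k := by
    refine intervalIntegral.integral_mono_on zero_le_one (ii_of_cont _ ?_)
      (ii_of_cont _ (slice_cont (fun s x => (u s x + 1) ^ k) (hvne k) t ht)) ?_
    · exact (slice_cont u hu' t ht).rpow_const (fun x hx => Or.inr (by linarith))
    · intro x hx
      exact Real.rpow_le_rpow (hn t ht0.le x hx) (by linarith) (by linarith)
  have hnn : 0 ≤ ∫ x in (0:ℝ)..1, u t x ^ k :=
    intervalIntegral.integral_nonneg zero_le_one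
      (fun x hx => Real.rpow_nonneg (hn t ht0.le x hx) _)
  have hK : 0 < (2 * C) ^ (1 / k) := by positivity
  have hT : 0 < t ^ (-(k - 1) / (α - 1)) := Real.rpow_pos_of_pos ht0 _
  have hKT := mul_pos hK hT
  rcases le_total 1 t with h1 | h1
  · have : t ^ (-(k - 1)) ≤ 1 := Real.rpow_le_one_of_one_le_of_nonpos h1 (by linarith)
    have h2 : ∫ x in (0:ℝ)..1, u t x ^ k ≤ 2 * C := by nlinarith
    have := Real.rpow_le_rpow hnn h2 (by positivity : 0 ≤ 1 / k)
    linarith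
  · have h3 : 1 ≤ t ^ (-(k - 1)) :=
      Real.one_le_rpow_of_pos_of_le_one_of_nonpos ht0 h1 (by linarith)
    have h2 : ∫ x in (0:ℝ)..1, u t x ^ k ≤ 2 * C * t ^ (-(k - 1)) := by nlinarith
    have h4 := Real.rpow_le_rpow hnn h2 (by positivity : 0 ≤ 1 / k)
    rw [Real.mul_rpow (by positivity) (by positivity), ← Real.rpow_mul ht0.le] at h4
    have h5 : t ^ (-(k - 1) * (1 / k)) ≤ t ^ (-(k - 1) / (α - 1)) := by
      apply Real.rpow_le_rpow_of_exponent_ge ht0 h1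
      rw [neg_div, neg_mul, neg_le_neg_iff, mul_one_div]
      have : 0 < α - 1 := by linarith
      gcongr
      linarith
    have h6 := mul_le_mul_of_nonneg_left h5 hK.le
    linarith
end

section
/- Let 1 ≤ α < 2, 1 < k < ∞, and 0 < m₀ < 1. There exists a constant C > 0, depending only on m₀, k and α, such that every nonnegative classical solution u of the one-dimensional nonlocal Fisher–KPP problem with initial mass ∫₀¹ u(0,x) dx = m₀ satisfies, for every t ≥ 0, ( ∫₀¹ u(t,x)^k dx )^{1/k} ≤ max{ ( ∫₀¹ u(0,x)^k dx )^{1/k}, C }. -/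
open Set Real MeasureTheory intervalIntegral

lemma kpp_barrier (f f' : ℝ → ℝ) (c : ℝ) (hc : ContinuousOn f (Ici 0))
    (hd : ∀ t, 0 < t → HasDerivAt f (f' t) t)
    (hneg : ∀ t, 0 < t → c < f t → f' t ≤ 0) (t : ℝ) (ht : 0 ≤ t) :
    f t ≤ max (f 0) c := by
  by_contra! hcon
  set B := max (f 0) c with hB
  have hIcc : ContinuousOn f (Icc 0 t) := hc.mono Icc_subset_Ici_self
  have hScl : IsClosed (Icc 0 t ∩ f ⁻¹' Iic B) :=
    hIcc.preimage_isClosed_of_isClosed isClosed_Icc isClosed_Iic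
  have hScomp : IsCompact (Icc 0 t ∩ f ⁻¹' Iic B) :=
    isCompact_Icc.of_isClosed_subset hScl inter_subset_left
  have hne : (Icc 0 t ∩ f ⁻¹' Iic B).Nonempty := ⟨0, ⟨le_rfl, ht⟩, show f 0 ≤ B from le_max_left _ _⟩
  obtain ⟨s, hs, hmax⟩ := hScomp.exists_isGreatest hne
  have hst : s ≤ t := hs.1.2
  have hgt : ∀ r, s < r → r ≤ t → B < f r := by
    intro r hr1 hr2
    by_contra! h
    have := hmax ⟨⟨hs.1.1.trans hr1.le, hr2⟩, h⟩
    linarith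
  have hanti : AntitoneOn f (Icc s t) := by
    apply antitoneOn_of_deriv_nonpos (convex_Icc s t)
    · exact hIcc.mono (Icc_subset_Icc_left hs.1.1)
    · rw [interior_Icc]
      intro r hr
      exact (hd r (hs.1.1.trans_lt hr.1)).differentiableAt.differentiableWithinAt
    · rw [interior_Icc]
      intro r hr
      have h0 : 0 < r := hs.1.1.trans_lt hr.1
      rw [(hd r h0).deriv]
      exact hneg r h0 ((le_max_right _ _).trans_lt (hgt r hr.1 hr.2.le))
  have h1 := hanti ⟨le_rfl, hst⟩ ⟨hst, le_rfl⟩ hst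
  have h2 : f s ≤ B := hs.2
  linarith

lemma kpp_cont_int (g : ℝ → ℝ → ℝ)
    (hg : ContinuousOn (fun p : ℝ × ℝ => g p.1 p.2) (Ici 0 ×ˢ Icc 0 1)) :
    ContinuousOn (fun t => ∫ x in (0:ℝ)..1, g t x) (Ici 0) := by
  have hcont : Continuous (fun p : ℝ × ℝ => g (max p.1 0) (max 0 (min p.2 1))) := by
    have hm : Continuous (fun p : ℝ × ℝ => ((max p.1 0, max 0 (min p.2 1)) : ℝ × ℝ)) := by
      fun_prop
    exact hg.comp_continuous hm (fun p => ⟨mem_Ici.2 (le_max_right _ _), mem_Icc.2 ⟨le_max_left _ _,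
      max_le zero_le_one (min_le_right _ _)⟩⟩)
  have h2 := intervalIntegral.continuous_parametric_intervalIntegral_of_continuous'
    (μ := volume) (f := fun t x => g (max t 0) (max 0 (min x 1))) hcont 0 1
  refine h2.continuousOn.congr ?_
  intro t ht
  apply intervalIntegral.integral_congr
  intro x hx
  rw [uIcc_of_le zero_le_one] at hx
  simp only
  rw [max_eq_left (show (0:ℝ) ≤ t from ht), min_eq_left hx.2, max_eq_right hx.1]

lemma kpp_slice {g : ℝ → ℝ → ℝ} {S : Set ℝ}
    (hg : ContinuousOn (fun p : ℝ × ℝ => g p.1 p.2) (S ×ˢ Icc 0 1)) {t : ℝ} (ht : t ∈ S) :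
    ContinuousOn (fun x => g t x) (Icc 0 1) :=
  hg.comp (f := fun x : ℝ => ((t, x) : ℝ × ℝ)) (by fun_prop) (fun _ hx => ⟨ht, hx⟩)

lemma kpp_ii {f : ℝ → ℝ} (hf : ContinuousOn f (Icc 0 1)) :
    IntervalIntegrable f volume 0 1 :=
  ContinuousOn.intervalIntegrable_of_Icc zero_le_one hf

lemma kpp_cmul (c : ℝ) {f : ℝ → ℝ} (hf : ContinuousOn f (Icc 0 1)) :
    ContinuousOn (fun x => c * f x) (Icc 0 1) := continuousOn_const.mul hf

lemma kpp_deriv_int (g gt : ℝ → ℝ → ℝ)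
    (hg : ContinuousOn (fun p : ℝ × ℝ => g p.1 p.2) (Ioi 0 ×ˢ Icc 0 1))
    (hgt : ContinuousOn (fun p : ℝ × ℝ => gt p.1 p.2) (Ioi 0 ×ˢ Icc 0 1))
    (hd : ∀ t ∈ Ioi (0:ℝ), ∀ x ∈ Icc (0:ℝ) 1, HasDerivAt (fun s => g s x) (gt t x) t)
    (t : ℝ) (ht : 0 < t) :
    HasDerivAt (fun s => ∫ x in (0:ℝ)..1, g s x) (∫ x in (0:ℝ)..1, gt t x) t := by
  have hsub : (Icc (t/2) (2*t)) ×ˢ (Icc (0:ℝ) 1) ⊆ Ioi 0 ×ˢ Icc 0 1 :=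
    prod_mono (fun s hs => lt_of_lt_of_le (by linarith) hs.1) le_rfl
  obtain ⟨K, hK⟩ := (isCompact_Icc.prod isCompact_Icc).exists_bound_of_continuousOn
    (hgt.mono hsub)
  have hnhds : Icc (t/2) (2*t) ∈ nhds t := Icc_mem_nhds (by linarith) (by linarith)
  have hΙ : uIoc (0:ℝ) 1 ⊆ Icc 0 1 := by
    rw [uIoc_of_le zero_le_one]; exact Ioc_subset_Icc_self
  refine (intervalIntegral.hasDerivAt_integral_of_dominated_loc_of_deriv_le
    (bound := fun _ => K) hnhds ?_ ?_ ?_ ?_ ?_ ?_).2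
  · filter_upwards [hnhds] with s hs
    have : s ∈ Ioi (0:ℝ) := lt_of_lt_of_le (by linarith) hs.1
    exact ((kpp_slice hg this).mono hΙ).aestronglyMeasurable measurableSet_uIoc
  · exact kpp_ii (kpp_slice hg ht)
  · exact ((kpp_slice hgt (mem_Ioi.2 ht)).mono hΙ).aestronglyMeasurable measurableSet_uIoc
  · refine Filter.Eventually.of_forall fun x hx s hs => ?_
    exact hK (s, x) ⟨hs, hΙ hx⟩
  · exact intervalIntegrable_const
  · refine Filter.Eventually.of_forall fun x hx s hs => ?_
    exact hd s (hsub (mk_mem_prod hs (hΙ hx))).1 x (hΙ hx)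

lemma kpp_osc (F f h : ℝ → ℝ) (hF : ContinuousOn F (Icc 0 1))
    (hd : ∀ x ∈ Ioo (0:ℝ) 1, HasDerivAt F (f x) x)
    (hf : ContinuousOn f (Icc 0 1)) (hh : ContinuousOn h (Icc 0 1))
    (hfh : ∀ x ∈ Icc (0:ℝ) 1, |f x| ≤ h x) (a b : ℝ) (ha : a ∈ Icc (0:ℝ) 1)
    (hb : b ∈ Icc (0:ℝ) 1) : F b - F a ≤ ∫ x in (0:ℝ)..1, h x := by
  have hsub : uIcc a b ⊆ Icc 0 1 := uIcc_subset_Icc ha hb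
  have hΙ : uIoc a b ⊆ Ioc 0 1 := by
    intro x hx
    rw [uIoc, mem_Ioc] at hx
    exact ⟨(le_min ha.1 hb.1).trans_lt hx.1, hx.2.trans (max_le ha.2 hb.2)⟩
  have hftc : ∫ x in a..b, f x = F b - F a := by
    apply intervalIntegral.integral_eq_sub_of_hasDeriv_right (hF.mono hsub)
    · intro x hx
      exact (hd x ⟨(le_min ha.1 hb.1).trans_lt hx.1,
        hx.2.trans_le (max_le ha.2 hb.2)⟩).hasDerivWithinAt
    · exact (hf.mono hsub).intervalIntegrable
  have hhi : IntegrableOn h (Ioc 0 1) :=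
    (hh.integrableOn_Icc).mono_set Ioc_subset_Icc_self
  have hfi : IntegrableOn f (Ioc 0 1) :=
    (hf.integrableOn_Icc).mono_set Ioc_subset_Icc_self
  have h0 : ∀ x ∈ Ioc (0:ℝ) 1, 0 ≤ h x := fun x hx =>
    (abs_nonneg _).trans (hfh x (Ioc_subset_Icc_self hx))
  rw [← hftc, intervalIntegral.integral_of_le zero_le_one]
  calc ∫ x in a..b, f x ≤ ‖∫ x in a..b, f x‖ := le_abs_self _
    _ ≤ ∫ x in uIoc a b, ‖f x‖ := intervalIntegral.norm_integral_le_integral_norm_uIoc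
    _ ≤ ∫ x in uIoc a b, h x := by
        apply setIntegral_mono_on (hfi.mono_set hΙ).norm (hhi.mono_set hΙ) measurableSet_uIoc
        intro x hx
        exact hfh x (Ioc_subset_Icc_self (hΙ hx))
    _ ≤ ∫ x in Ioc 0 1, h x := by
        apply setIntegral_mono_set hhi
        · exact (ae_restrict_iff' measurableSet_Ioc).2 (Filter.Eventually.of_forall h0)
        · exact hΙ.eventuallyLE

/-- the constant -/
noncomputable def kppC (k : ℝ) : ℝ := 4 + 16 * ((k+1)/2)^2 / (k-1)

lemma kpp_key (α k : ℝ) (hα1 : 1 ≤ α) (hα2 : α < 2) (hk : 1 < k) (w w' : ℝ → ℝ)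
    (hw : ContinuousOn w (Icc 0 1)) (hw' : ContinuousOn w' (Icc 0 1))
    (hpos : ∀ x ∈ Icc (0:ℝ) 1, 0 < w x)
    (hd : ∀ x ∈ Icc (0:ℝ) 1, HasDerivWithinAt w (w' x) (Icc 0 1) x)
    (hM : ∫ x in (0:ℝ)..1, w x ≤ 2)
    (hY : (kppC k)^k < ∫ x in (0:ℝ)..1, w x ^ k) :
    ∫ x in (0:ℝ)..1, w x ^ (k+α-1) ≤ (k-1) * ∫ x in (0:ℝ)..1, w x ^ (k-2) * (w' x)^2 := by
  have hne : (Icc (0:ℝ) 1).Nonempty := ⟨0, by simp⟩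
  have hrp : ∀ q : ℝ, ContinuousOn (fun x => w x ^ q) (Icc 0 1) := fun q =>
    hw.rpow_const (fun x hx => Or.inl (hpos x hx).ne')
  obtain ⟨a, ha, hmin⟩ := isCompact_Icc.exists_isMinOn hne hw
  obtain ⟨b, hb, hmax⟩ := isCompact_Icc.exists_isMaxOn hne hw
  set W := w b with hW
  have hWpos : 0 < W := hpos b hb
  have hapos := hpos a ha
  have hC : 0 < kppC k := by
    unfold kppC
    have : 0 < k - 1 := by linarith
    positivity
  -- W large
  have hWC : kppC k < W := by
    have h1 : ∫ x in (0:ℝ)..1, w x ^ k ≤ ∫ x in (0:ℝ)..1, W ^ k := by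
      apply intervalIntegral.integral_mono_on zero_le_one (kpp_ii (hrp k)) intervalIntegrable_const
      intro x hx
      exact rpow_le_rpow (hpos x hx).le (hmax hx) (by linarith)
    simp at h1
    have h2 := hY.trans_le h1
    exact (rpow_lt_rpow_iff hC.le hWpos.le (by linarith)).1 h2
  have ha2 : w a ≤ 2 := by
    have h1 : ∫ x in (0:ℝ)..1, w a ≤ ∫ x in (0:ℝ)..1, w x := by
      apply intervalIntegral.integral_mono_on zero_le_one intervalIntegrable_const (kpp_ii hw)
      intro x hx
      exact hmin hx
    simp at h1
    linarith
  set p := (k+1)/2 with hp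
  have hp1 : 1 < p := by rw [hp]; linarith
  have hk1 : 0 < k - 1 := by linarith
  have hW4 : 4 ≤ W := by
    have : 0 ≤ 16 * p^2/(k-1) := by positivity
    unfold kppC at hWC
    linarith
  have hWk : 16 * p^2 ≤ (k-1) * W := by
    unfold kppC at hWC
    have : 16 * p^2/(k-1) ≤ W := by rw [hp]; linarith
    rw [div_le_iff₀ hk1] at this
    linarith
  set D := ∫ x in (0:ℝ)..1, w x ^ (k-2) * (w' x)^2 with hD
  set P := W ^ p with hP
  have hPpos : 0 < P := rpow_pos_of_pos hWpos _
  have hcD : ContinuousOn (fun x => w x ^ (k-2) * (w' x)^2) (Icc 0 1) := (hrp _).mul (hw'.pow 2)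
  -- oscillation
  have hosc : P - w a ^ p ≤ ∫ x in (0:ℝ)..1,
      ((P/8) * w x + (2*p^2/P) * (w x ^ (k-2) * (w' x)^2)) := by
    apply kpp_osc (fun x => w x ^ p) (fun x => w' x * p * w x ^ (p-1)) _ (hrp p) _ _ _ _ a b ha hb
    · intro x hx
      have h1 := (hd x (Ioo_subset_Icc_self hx)).hasDerivAt (Icc_mem_nhds hx.1 hx.2)
      exact h1.rpow_const (Or.inl (hpos x (Ioo_subset_Icc_self hx)).ne')
    · exact (hw'.mul continuousOn_const).mul (hrp _)
    · exact (kpp_cmul _ hw).add (kpp_cmul _ hcD)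
    · intro x hx
      have hx0 := hpos x hx
      set A := w x ^ ((1:ℝ)/2) with hA
      set E := w x ^ ((k-2)/2) with hE
      have e1 : w x = A^2 := by
        rw [hA, ← rpow_natCast, ← rpow_mul hx0.le]; norm_num
      have e2 : w x ^ (k-2) = E^2 := by
        rw [hE, ← rpow_natCast, ← rpow_mul hx0.le]; norm_num
      have e3 : w x ^ (p-1) = A * E := by
        rw [hA, hE, ← rpow_add hx0]; congr 1; rw [hp]; ring
      have hApos : 0 < A := rpow_pos_of_pos hx0 _
      have hEpos : 0 < E := rpow_pos_of_pos hx0 _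
      rw [e2, e3, abs_mul, abs_mul, abs_of_pos (mul_pos hApos hEpos), abs_of_pos (by linarith : 0 < p)]
      rw [show P / 8 * w x = P/8 * A^2 by rw [← e1], ← sq_abs (w' x)]
      set d := |w' x|
      have : P / 8 * A ^ 2 + 2 * p ^ 2 / P * (E ^ 2 * d ^ 2) - d * p * (A * E)
          = (P * A - 4 * p * E * d)^2 / (8 * P) := by
        field_simp
        ring
      have h2 : 0 ≤ (P * A - 4 * p * E * d)^2 / (8 * P) := by positivity
      linarith
  rw [intervalIntegral.integral_add (kpp_ii (kpp_cmul _ hw))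
    (kpp_ii (kpp_cmul _ hcD)), intervalIntegral.integral_const_mul,
    intervalIntegral.integral_const_mul, ← hD] at hosc
  have hap : w a ^ p ≤ P / 2 := by
    have h1 : w a ^ p ≤ 2 ^ p := rpow_le_rpow hapos.le ha2 (by linarith)
    have h2 : P = 2 ^ p * (W/2)^p := by
      rw [← mul_rpow (by norm_num) (by positivity)]
      rw [hP]; congr 1; ring
    have h3 : (2:ℝ) ≤ (W/2)^p := by
      calc (2:ℝ) ≤ W/2 := by linarith
        _ ≤ (W/2)^p := self_le_rpow_of_one_le (by linarith) hp1.le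
    have h4 : (0:ℝ) < 2 ^ p := by positivity
    rw [h2]
    nlinarith
  have hDlow : P^2 ≤ 8 * p^2 * D := by
    have h1 : P / 4 ≤ 2*p^2/P * D := by nlinarith
    have h2 : 2*p^2/P * D = 2*p^2*D/P := by ring
    rw [h2, le_div_iff₀ hPpos] at h1
    linarith
  have hPsq : P^2 = W ^ (k+1) := by
    rw [hP, ← rpow_natCast, ← rpow_mul hWpos.le]; congr 1; rw [hp]; push_cast; ring
  have hup : ∫ x in (0:ℝ)..1, w x ^ (k+α-1) ≤ W ^ (k+α-2) * 2 := by
    have h1 : ∫ x in (0:ℝ)..1, w x ^ (k+α-1) ≤ ∫ x in (0:ℝ)..1, W ^ (k+α-2) * w x := by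
      apply intervalIntegral.integral_mono_on zero_le_one (kpp_ii (hrp _))
        (kpp_ii (kpp_cmul _ hw))
      intro x hx
      have hx0 := hpos x hx
      rw [show k+α-1 = (k+α-2) + 1 by ring, rpow_add_one hx0.ne']
      gcongr
      · linarith
      · exact hmax hx
    rw [intervalIntegral.integral_const_mul] at h1
    have : 0 < W ^ (k+α-2) := rpow_pos_of_pos hWpos _
    nlinarith
  have hW1 : W ^ (k+α-2) * W ≤ W ^ (k+1) := by
    rw [← rpow_add_one hWpos.ne']
    exact rpow_le_rpow_of_exponent_le (by linarith) (by linarith)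
  have hQ : 0 < W ^ (k+α-2) := rpow_pos_of_pos hWpos _
  set Q := W ^ (k+α-2)
  have h5 : Q * (16 * p^2) ≤ (k-1) * (8 * p^2 * D) := by
    calc Q * (16 * p^2) ≤ Q * ((k-1) * W) := by gcongr
      _ = (k-1) * (Q * W) := by ring
      _ ≤ (k-1) * (8 * p^2 * D) := by
        rw [hPsq] at hDlow
        exact mul_le_mul_of_nonneg_left (hW1.trans hDlow) hk1.le
  have h6 : 0 < 8 * p^2 := by positivity
  have h7 : (8 * p^2) * (Q * 2) ≤ (8 * p^2) * ((k-1) * D) := by linarith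
  exact hup.trans (le_of_mul_le_mul_left h7 h6)

lemma kpp_mass (α : ℝ) (u ut ux uxx : ℝ → ℝ → ℝ)
    (h : IsKPPSolution α u ut ux uxx) (hn : KPPNonneg u)
    (h0 : ∫ x in (0:ℝ)..1, u 0 x ≤ 1) (t : ℝ) (ht : 0 ≤ t) :
    ∫ x in (0:ℝ)..1, u t x ≤ 1 := by
  obtain ⟨hu, hut, hux, huxx, hdt, hdx, hdxx, hpde, hbc⟩ := h
  have hu' : ContinuousOn (fun p : ℝ × ℝ => u p.1 p.2) (Ioi 0 ×ˢ Icc 0 1) :=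
    hu.mono (prod_mono Ioi_subset_Ici_self le_rfl)
  have := kpp_barrier (fun t => ∫ x in (0:ℝ)..1, u t x) (fun t => ∫ x in (0:ℝ)..1, ut t x) 1
    (kpp_cont_int u hu) (kpp_deriv_int u ut hu' hut hdt) ?_ t ht
  · exact this.trans (max_le h0 le_rfl)
  · intro s hs hs1
    have hI : ∫ x in (0:ℝ)..1, uxx s x = 0 := by
      rw [intervalIntegral.integral_eq_sub_of_hasDerivAt_of_le zero_le_one (kpp_slice hux hs)
        (fun x hx => (hdxx s hs x (Ioo_subset_Icc_self hx)).hasDerivAt (Icc_mem_nhds hx.1 hx.2))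
        (kpp_ii (kpp_slice huxx hs)), (hbc s hs).1, (hbc s hs).2, sub_zero]
    refine le_of_le_of_eq ?_ hI
    apply intervalIntegral.integral_mono_on zero_le_one (kpp_ii (kpp_slice hut hs))
      (kpp_ii (kpp_slice huxx hs))
    intro x hx
    rw [hpde s hs x hx]
    have : 0 ≤ u s x ^ α := rpow_nonneg (hn s (le_of_lt hs) x hx) _
    nlinarith

lemma kpp_eps (α k : ℝ) (hα1 : 1 ≤ α) (hα2 : α < 2) (hk : 1 < k) (u ut ux uxx : ℝ → ℝ → ℝ)
    (h : IsKPPSolution α u ut ux uxx) (hn : KPPNonneg u)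
    (h0 : ∫ x in (0:ℝ)..1, u 0 x ≤ 1) (ε : ℝ) (hε : 0 < ε) (hε1 : ε ≤ 1) (t : ℝ) (ht : 0 ≤ t) :
    ∫ x in (0:ℝ)..1, (u t x + ε) ^ k ≤ max (∫ x in (0:ℝ)..1, (u 0 x + ε) ^ k) (kppC k ^ k) := by
  have hmass := kpp_mass α u ut ux uxx h hn h0
  obtain ⟨hu, hut, hux, huxx, hdt, hdx, hdxx, hpde, hbc⟩ := h
  have hsub : Ioi (0:ℝ) ×ˢ Icc (0:ℝ) 1 ⊆ Ici 0 ×ˢ Icc 0 1 := prod_mono Ioi_subset_Ici_self le_rfl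
  have hpos : ∀ t, 0 ≤ t → ∀ x ∈ Icc (0:ℝ) 1, 0 < u t x + ε := fun t ht x hx =>
    add_pos_of_nonneg_of_pos (hn t ht x hx) hε
  have hc : ∀ q : ℝ, ContinuousOn (fun p : ℝ × ℝ => (u p.1 p.2 + ε) ^ q) (Ici 0 ×ˢ Icc 0 1) :=
    fun q => (hu.add continuousOn_const).rpow_const
      (fun p hp => Or.inl (hpos p.1 hp.1 p.2 hp.2).ne')
  refine kpp_barrier (fun t => ∫ x in (0:ℝ)..1, (u t x + ε) ^ k)
    (fun t => ∫ x in (0:ℝ)..1, ut t x * k * (u t x + ε) ^ (k-1)) _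
    (kpp_cont_int (fun t x => (u t x + ε)^k) (hc k))
    (kpp_deriv_int (fun t x => (u t x + ε)^k) (fun t x => ut t x * k * (u t x + ε) ^ (k-1))
      ((hc k).mono hsub) ((hut.mul continuousOn_const).mul ((hc (k-1)).mono hsub)) ?_) ?_ t ht
  · intro s hs x hx
    exact ((hdt s hs x hx).add_const ε).rpow_const (Or.inl (hpos s (le_of_lt hs) x hx).ne')
  · intro s hs hYs
    have hs0 : (0:ℝ) ≤ s := le_of_lt hs
    have cu := kpp_slice hu (mem_Ici.2 hs0)
    have cux := kpp_slice hux (mem_Ioi.2 hs)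
    have cuxx := kpp_slice huxx (mem_Ioi.2 hs)
    have cut := kpp_slice hut (mem_Ioi.2 hs)
    have cw : ContinuousOn (fun x => u s x + ε) (Icc 0 1) := cu.add continuousOn_const
    have cq : ∀ q : ℝ, ContinuousOn (fun x => (u s x + ε)^q) (Icc 0 1) := fun q =>
      cw.rpow_const (fun x hx => Or.inl (hpos s hs0 x hx).ne')
    have hkey := kpp_key α k hα1 hα2 hk (fun x => u s x + ε) (fun x => ux s x)
      cw cux (hpos s hs0) (fun x hx => (hdx s hs x hx).add_const ε) (by
        rw [intervalIntegral.integral_add (kpp_ii cu) intervalIntegrable_const]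
        have := hmass s hs0
        simp
        linarith) hYs
    have cA : ContinuousOn (fun x => uxx s x * (u s x + ε)^(k-1)) (Icc 0 1) := cuxx.mul (cq _)
    have cB : ContinuousOn (fun x => (u s x + ε)^(k-2) * (ux s x)^2) (Icc 0 1) :=
      (cq _).mul (cux.pow 2)
    have hparts : (∫ x in (0:ℝ)..1, uxx s x * (u s x + ε)^(k-1))
        + (k-1) * ∫ x in (0:ℝ)..1, (u s x + ε)^(k-2) * (ux s x)^2 = 0 := by
      rw [← intervalIntegral.integral_const_mul, ← intervalIntegral.integral_add (kpp_ii cA)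
        (kpp_ii (kpp_cmul _ cB))]
      rw [intervalIntegral.integral_eq_sub_of_hasDerivAt_of_le
        (f := fun x => ux s x * (u s x + ε)^(k-1))
        (f' := fun x => uxx s x * (u s x + ε)^(k-1) + (k-1) * ((u s x + ε)^(k-2) * (ux s x)^2)) zero_le_one (cux.mul (cq _)) _
        (kpp_ii (cA.add (kpp_cmul _ cB)))]
      · simp [(hbc s hs).1, (hbc s hs).2]
      · intro x hx
        have hxI := Ioo_subset_Icc_self hx
        have hN : Icc (0:ℝ) 1 ∈ nhds x := Icc_mem_nhds hx.1 hx.2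
        have d1 := (hdxx s hs x hxI).hasDerivAt hN
        have d2 := (((hdx s hs x hxI).hasDerivAt hN).add_const ε).rpow_const (p := k-1)
          (Or.inl (hpos s hs0 x hxI).ne')
        refine (d1.mul d2).congr_deriv ?_
        rw [show k - 1 - 1 = k - 2 by ring]
        ring
    have hle : ∫ x in (0:ℝ)..1, ut s x * k * (u s x + ε) ^ (k-1) ≤
        ∫ x in (0:ℝ)..1, (k * (uxx s x * (u s x + ε)^(k-1)) + k * (u s x + ε)^(k+α-1)) := by
      apply intervalIntegral.integral_mono_on zero_le_one
        (kpp_ii ((cut.mul continuousOn_const).mul (cq _)))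
        (kpp_ii ((kpp_cmul _ cA).add (kpp_cmul _ (cq _))))
      intro x hx
      change ut s x * k * (u s x + ε) ^ (k-1) ≤
        k * (uxx s x * (u s x + ε)^(k-1)) + k * (u s x + ε)^(k+α-1)
      have hw := hpos s hs0 x hx
      have hux0 := hn s hs0 x hx
      rw [hpde s hs x hx, show k+α-1 = α + (k-1) by ring, rpow_add hw]
      have h1 : u s x ^ α * (1 - ∫ y in (0:ℝ)..1, u s y) ≤ (u s x + ε)^α := by
        have hm0 : 0 ≤ ∫ y in (0:ℝ)..1, u s y :=
          intervalIntegral.integral_nonneg zero_le_one (fun y hy => hn s hs0 y hy)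
        have h2 : u s x ^ α ≤ (u s x + ε)^α := rpow_le_rpow hux0 (by linarith) (by linarith)
        have h3 : 0 ≤ u s x ^ α := rpow_nonneg hux0 _
        nlinarith
      have h4 : 0 < k * (u s x + ε)^(k-1) := mul_pos (by linarith) (rpow_pos_of_pos hw _)
      have h5 := mul_le_mul_of_nonneg_right h1 h4.le
      linarith
    rw [intervalIntegral.integral_add (kpp_ii (kpp_cmul _ cA))
      (kpp_ii (kpp_cmul _ (cq _))), intervalIntegral.integral_const_mul,
      intervalIntegral.integral_const_mul] at hle
    refine hle.trans ?_
    have hk0 : 0 < k := by linarith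
    have : (∫ x in (0:ℝ)..1, uxx s x * (u s x + ε)^(k-1))
      + ∫ x in (0:ℝ)..1, (u s x + ε)^(k+α-1) ≤ 0 := by linarith
    nlinarith

/-- **Uniform `L^k` bound, subcritical mass.**  For `1 ≤ α < 2`, `k > 1` and `0 < m₀ < 1`
there is `C = C(m₀,k,α) > 0` such that every nonnegative classical solution with initial
mass `m₀` satisfies `‖u(t)‖_{L^k} ≤ max(‖u(0)‖_{L^k}, C)` for all `t ≥ 0`. -/
theorem Lk_uniform_subcritical (α k m₀ : ℝ) (hα1 : 1 ≤ α) (hα2 : α < 2)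
    (hk : 1 < k) (hm₀ : 0 < m₀) (hm₀1 : m₀ < 1) :
    ∃ C > (0:ℝ), ∀ u ut ux uxx : ℝ → ℝ → ℝ,
      IsKPPSolution α u ut ux uxx → KPPNonneg u →
      (∫ x in (0:ℝ)..1, u 0 x) = m₀ →
      ∀ t ∈ Ici (0:ℝ),
        (∫ x in (0:ℝ)..1, u t x ^ k) ^ (1 / k)
          ≤ max ((∫ x in (0:ℝ)..1, u 0 x ^ k) ^ (1 / k)) C := by
  refine ⟨kppC k, ?_, ?_⟩
  · unfold kppC
    have : 0 < k - 1 := by linarith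
    positivity
  have hC : 0 < kppC k := by
    unfold kppC
    have : 0 < k - 1 := by linarith
    positivity
  intro u ut ux uxx h hn hm t ht
  have hk0 : 0 < k := by linarith
  have ht0 : (0:ℝ) ≤ t := ht
  have hu := h.1
  have cu0 := kpp_slice hu (mem_Ici.2 (le_refl (0:ℝ)))
  have cut := kpp_slice hu ht
  have hcont := kpp_cont_int (fun e x => (u 0 x + e) ^ k) (by
    apply ContinuousOn.rpow_const
    · apply ContinuousOn.add
      · exact cu0.comp continuousOn_snd (fun p hp => hp.2)
      · exact continuousOn_fst
    · exact fun p _ => Or.inr hk0.le)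
  have htend : Filter.Tendsto (fun e => max (∫ x in (0:ℝ)..1, (u 0 x + e) ^ k) (kppC k ^ k))
      (nhdsWithin 0 (Ioi 0)) (nhds (max (∫ x in (0:ℝ)..1, (u 0 x) ^ k) (kppC k ^ k))) := by
    have h1 := (hcont 0 (mem_Ici.2 le_rfl)).tendsto.mono_left
      (nhdsWithin_mono 0 Ioi_subset_Ici_self)
    simp only [add_zero] at h1
    exact h1.max tendsto_const_nhds
  have hmain : ∫ x in (0:ℝ)..1, u t x ^ k ≤ max (∫ x in (0:ℝ)..1, (u 0 x) ^ k) (kppC k ^ k) := by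
    refine ge_of_tendsto htend ?_
    filter_upwards [Ioc_mem_nhdsGT (zero_lt_one (α := ℝ))] with e he
    refine le_trans ?_ (kpp_eps α k hα1 hα2 hk u ut ux uxx h hn (by linarith) e he.1 he.2 t ht0)
    apply intervalIntegral.integral_mono_on zero_le_one
    · exact kpp_ii (cut.rpow_const fun x _ => Or.inr hk0.le)
    · exact kpp_ii ((cut.add continuousOn_const).rpow_const fun x _ => Or.inr hk0.le)
    · intro x hx
      exact rpow_le_rpow (hn t ht x hx) (by linarith [he.1]) hk0.le
  have hnn : 0 ≤ ∫ x in (0:ℝ)..1, u t x ^ k :=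
    intervalIntegral.integral_nonneg zero_le_one (fun x hx => rpow_nonneg (hn t ht x hx) _)
  have h1k : 0 ≤ 1 / k := by positivity
  rcases le_max_iff.1 hmain with h1 | h1
  · exact le_max_of_le_left (rpow_le_rpow hnn h1 h1k)
  · apply le_max_of_le_right
    refine (rpow_le_rpow hnn h1 h1k).trans ?_
    rw [← rpow_mul hC.le, mul_one_div_cancel hk0.ne', rpow_one]
end
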